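/- arXiv:1007.1289 — 2 statements merged into one kernel-verified Lean document; each statement's English description precedes it below -/
import Mathlib

section
/- Let n ≥ 1. Define ρ, τ : Fin n → ℤ by ρ_i = n − i and τ_i = n − 1 − i for 0 ≤ i ≤ n−1, and for k ∈ ℕ define μ⁽ᵏ⁾ : Fin n → ℤ by μ⁽ᵏ⁾_0 = k and μ⁽ᵏ⁾_i = 0 for 1 ≤ i ≤ n−1. Then μ⁽ᵏ⁾ − ρ is signed-permutation-equivalent to τ if and only if k = n. -/
/-- Two vectors `v, w : Fin n → ℤ` are signed-permutation-equivalent if there are a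
permutation `σ` of `Fin n` and signs `ε : Fin n → {1, −1}` with
`v i = ε i * w (σ i)` for all `i`. -/
def SignedPermEquiv {n : ℕ} (v w : Fin n → ℤ) : Prop :=
  ∃ (σ : Equiv.Perm (Fin n)) (ε : Fin n → ℤ),
    (∀ i, ε i = 1 ∨ ε i = -1) ∧ ∀ i, v i = ε i * w (σ i)

/-- Combinatorial core of the computation of the Dirac cohomology of the two
metaplectic representations of `Sp(2n, ℂ)`: `ρ = (n, n−1, …, 1)` is the half-sum of
positive roots of `sp(2n)`, `τ = 2λ − ρ` with `2λ = (2n−1, 2n−3, …, 1)` is the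
prescribed highest weight of the Dirac cohomology, `μ⁽ᵏ⁾ = (k, 0, …, 0)` ranges over
the highest weights of the `K`-types of the metaplectic representations, and the
Weyl group of type `C` acts by signed permutations.  The conclusion, `k = n`, shows
that exactly one of `π_even`, `π_odd` (according to the parity of `n`) has nonzero
Dirac cohomology. -/
theorem stmt14 (n : ℕ) (hn : 1 ≤ n) (k : ℕ)
    (ρ τ μ : Fin n → ℤ)
    (hρ : ∀ i : Fin n, ρ i = (n : ℤ) - (i : ℕ))
    (hτ : ∀ i : Fin n, τ i = (n : ℤ) - 1 - (i : ℕ))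
    (hμ : ∀ i : Fin n, μ i = if (i : ℕ) = 0 then (k : ℤ) else 0) :
    SignedPermEquiv (fun i => μ i - ρ i) τ ↔ k = n := by
  constructor
  · rintro ⟨σ, ε, -, h⟩
    have h0 := h (σ.symm ⟨n - 1, by omega⟩)
    simp only [Equiv.apply_symm_apply, hτ, hρ, hμ] at h0
    have hz : (n : ℤ) - 1 - ((n - 1 : ℕ) : ℤ) = 0 := by omega
    have hlt := (σ.symm ⟨n - 1, by omega⟩).isLt
    rw [hz, mul_zero] at h0
    split_ifs at h0 <;> omega
  · rintro rfl
    obtain ⟨m, rfl⟩ : ∃ m, k = m + 1 := ⟨k - 1, by omega⟩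
    refine ⟨(finRotate (m + 1)).symm, fun _ => -1, fun _ => Or.inr rfl, fun i => ?_⟩
    obtain ⟨j, rfl⟩ := (finRotate (m + 1)).surjective i
    have hj := j.isLt
    have hr : (finRotate (m + 1) j : ℕ) = if (j : ℕ) = m then 0 else (j : ℕ) + 1 := by
      simpa only [Fin.ext_iff, Fin.val_last] using coe_finRotate j
    simp only [Equiv.symm_apply_apply, hτ, hρ, hμ]
    split_ifs at hr ⊢ <;> omega
end

section
/- Let a, b be integers with 1 ≤ a ≤ b and let n = a + b. Define ρ, τ : Fin n → ℤ by ρ_i = a + b − 1 − i and τ_i = max(b − a − 1 − i, 0) for 0 ≤ i ≤ n−1. For a weakly decreasing sequence of natural numbers α₁ ≥ α₂ ≥ ... ≥ α_{2a} ≥ 0, define μ : Fin n → ℤ by μ_i = α_{i+1} for 0 ≤ i ≤ 2a−1 and μ_i = 0 for 2a ≤ i ≤ n−1. Then μ − ρ is signed-permutation-equivalent to τ if and only if α_j = a + b − j for all 1 ≤ j ≤ 2a. -/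
/-- The rotation of `Fin n` sending `i` to `i + (n - k)` for `i < k` and to `i - k` otherwise. -/
def blockSwap (n k : ℕ) (hk : k ≤ n) : Equiv.Perm (Fin n) where
  toFun i := ⟨if (i : ℕ) < k then i + (n - k) else i - k, by split <;> omega⟩
  invFun j := ⟨if (j : ℕ) < n - k then j + k else j - (n - k), by split <;> omega⟩
  left_inv i := by ext; dsimp only; split_ifs <;> omega
  right_inv j := by ext; dsimp only; split_ifs <;> omega

theorem blockSwap_val (n k : ℕ) (hk : k ≤ n) (i : Fin n) :
    (blockSwap n k hk i : ℕ) = if (i : ℕ) < k then (i : ℕ) + (n - k) else (i : ℕ) - k := rfl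

theorem SignedPermEquiv.sum_abs_eq {n : ℕ} {v w : Fin n → ℤ} (h : SignedPermEquiv v w) :
    ∑ i, |v i| = ∑ i, |w i| := by
  obtain ⟨σ, ε, hε, h⟩ := h
  rw [← Equiv.sum_comp σ (fun i => |w i|)]
  refine Finset.sum_congr rfl fun i _ => ?_
  rcases hε i with hi | hi <;> simp [h i, hi]


/-- Combinatorial core of the computation of the Dirac cohomology of the two
unipotent representations of `SO(2n, ℂ)` attached to the nilpotent orbit with
columns `2b, 2a−1, 1`.  Here `ρ` is the half-sum of positive roots of `so(2n)`,
`τ = 2λ − ρ` is the prescribed highest weight of the Dirac cohomology, `μ` ranges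
over the highest weights of the `K`-types of the two representations (distinguished
by the parity of `∑ αⱼ`); since `τ` has a zero coordinate, the type `D` Weyl group
condition may be replaced by arbitrary signed permutations.  The conclusion shows
that exactly one of the two representations (according to the parity of `a`) has
nonzero Dirac cohomology. -/
theorem stmt15 (a b : ℕ) (ha : 1 ≤ a) (hab : a ≤ b) (n : ℕ) (hn : n = a + b)
    (α : Fin (2 * a) → ℕ) (hα : ∀ i j : Fin (2 * a), i ≤ j → α j ≤ α i)
    (ρ τ μ : Fin n → ℤ)
    (hρ : ∀ i : Fin n, ρ i = (a : ℤ) + b - 1 - (i : ℕ))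
    (hτ : ∀ i : Fin n, τ i = max ((b : ℤ) - a - 1 - (i : ℕ)) 0)
    (hμ : ∀ i : Fin n, μ i =
      if h : (i : ℕ) < 2 * a then (α ⟨(i : ℕ), h⟩ : ℤ) else 0) :
    SignedPermEquiv (fun i => μ i - ρ i) τ ↔
      ∀ j : Fin (2 * a), (α j : ℤ) = (a : ℤ) + b - ((j : ℕ) + 1) := by
  have hk : 2 * a ≤ n := by omega
  have hτσ : ∀ i : Fin n, τ (blockSwap n (2 * a) hk i) =
      if (i : ℕ) < 2 * a then 0 else ρ i := by
    intro i
    rw [hτ, hρ, blockSwap_val]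
    split_ifs <;> omega
  constructor
  · intro h j
    have hle : ∀ i ∈ Finset.univ, |τ (blockSwap n (2 * a) hk i)| ≤ |μ i - ρ i| := by
      intro i _
      rw [hτσ, hμ]
      split_ifs <;> simp
    have hsum : ∑ i, |τ (blockSwap n (2 * a) hk i)| = ∑ i, |μ i - ρ i| :=
      (Equiv.sum_comp (blockSwap n (2 * a) hk) (fun i => |τ i|)).trans h.sum_abs_eq.symm
    have hj := (Finset.sum_eq_sum_iff_of_le hle).1 hsum ⟨j, by omega⟩ (Finset.mem_univ _)
    rw [hτσ, hμ, hρ] at hj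
    simp only [j.isLt, if_true, dif_pos, abs_zero, Fin.eta] at hj
    have := abs_eq_zero.1 hj.symm
    omega
  · intro h
    refine ⟨blockSwap n (2 * a) hk, fun _ => -1, fun _ => Or.inr rfl, fun i => ?_⟩
    simp only [hτσ, hμ]
    split_ifs with hi
    · rw [h, hρ]
      ring
    · ring
end
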